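/- arXiv:1509.07377 — 2 statements merged into one kernel-verified Lean document; each statement's English description precedes it below -/
import Mathlib

section
/- Let (K, ≤K) be an abstract elementary class in a finitary first-order language L with Löwenheim–Skolem number LS(K) = χ. Then there exist: a finitary first-order language L₁ ⊇ L obtained from L by adding at most χ new function symbols (of finite arities); a first-order L₁-theory T₁ with |T₁| ≤ χ; and a set Γ of at most 2^χ partial types, each a set of first-order L₁-formulas in a fixed finite tuple of free variables, such that K = { M₁ ↾ L : M₁ is an L₁-structure, M₁ ⊨ T₁, and M₁ omits every p ∈ Γ }, where M₁ omits p if no tuple from M₁ realizes every formula of p, and M₁ ↾ L denotes the reduct of M₁ to L. -/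
universe u

open FirstOrder Cardinal

/-- An `L`-structure whose underlying set is a subset of the fixed set-theoretic
universe `τ`. -/
structure SubStruct (L : FirstOrder.Language.{u, u}) (τ : Type u) : Type u where
  carrier : Set τ
  str : L.Structure carrier

attribute [instance] SubStruct.str

namespace SubStruct

variable {L : FirstOrder.Language.{u, u}} {τ : Type u}

/-- `M` is an `L`-substructure of `N` : the carrier of `M` is a subset of that of `N`
and the inclusion map is an `L`-embedding. -/
def Sub (M N : SubStruct L τ) : Prop :=
  ∃ f : M.carrier ↪[L] N.carrier, ∀ x : M.carrier, (f x : τ) = (x : τ)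

end SubStruct

variable {L : FirstOrder.Language.{u, u}} {τ : Type u}

/-- The axioms of an abstract elementary class `(K, ≤K)` in the finitary language `L`
(Löwenheim–Skolem–Tarski axiom not included; see `IsLSWitness`). -/
structure IsAEC (K : Set (SubStruct L τ))
    (lei : SubStruct L τ → SubStruct L τ → Prop) : Prop where
  refl : ∀ M ∈ K, lei M M
  trans : ∀ M N P : SubStruct L τ, lei M N → lei N P → lei M P
  sub_of_lei : ∀ M N : SubStruct L τ, M ∈ K → N ∈ K → lei M N → M.Sub N
  iso_closed : ∀ (N N' : SubStruct L τ) (f : N.carrier ≃[L] N'.carrier), N ∈ K →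
    N' ∈ K ∧ ∀ M ∈ K, lei M N →
      ∃ M' ∈ K, lei M' N' ∧
        M'.carrier = {y : τ | ∃ x : N.carrier, (x : τ) ∈ M.carrier ∧ (f x : τ) = y}
  coherence : ∀ M₀ M₁ M₂ : SubStruct L τ, M₀ ∈ K → M₁ ∈ K → M₂ ∈ K →
    lei M₀ M₂ → lei M₁ M₂ → M₀.Sub M₁ → lei M₀ M₁
  tarskiVaught : ∀ (I : Type u) [Preorder I] (D : I → SubStruct L τ), Nonempty I →
    (∀ i j : I, ∃ k, i ≤ k ∧ j ≤ k) →
    (∀ i, D i ∈ K) → (∀ i j : I, i ≤ j → lei (D i) (D j)) →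
    ∃ Un ∈ K, Un.carrier = ⋃ i, (D i).carrier ∧
      (∀ j, lei (D j) Un) ∧ ∀ N ∈ K, (∀ i, lei (D i) N) → lei Un N

/-- `lam` witnesses the Löwenheim–Skolem–Tarski axiom for the abstract class
`(K, lei)` : `lam ≥ |L| + ℵ₀` and every subset `A` of a member `M` of `K` is contained in
some `N ≤K M` with `|N| ≤ |A| + lam`. -/
def IsLSWitness (K : Set (SubStruct L τ))
    (lei : SubStruct L τ → SubStruct L τ → Prop) (lam : Cardinal.{u}) : Prop :=
  L.card + ℵ₀ ≤ lam ∧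
    ∀ M ∈ K, ∀ A : Set τ, A ⊆ M.carrier →
      ∃ N ∈ K, lei N M ∧ A ⊆ N.carrier ∧ #N.carrier ≤ #A + lam

open FirstOrder.Language FirstOrder.Language.Structure

namespace SubStruct

theorem sub_iff {M N : SubStruct L τ} :
    M.Sub N ↔ M.carrier ⊆ N.carrier ∧
      ∀ (n : ℕ) (x : Fin n → M.carrier) (y : Fin n → N.carrier), (∀ k, (x k : τ) = y k) →
        (∀ f : L.Functions n, ((funMap f x : M.carrier) : τ) = (funMap f y : N.carrier)) ∧
          ∀ R : L.Relations n, RelMap R x ↔ RelMap R y := by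
  constructor
  · rintro ⟨f, hf⟩
    refine ⟨fun x hx => by simpa [hf] using (f ⟨x, hx⟩).2, fun n x y hxy => ?_⟩
    obtain rfl : f ∘ x = y := funext fun k => Subtype.ext ((hf _).trans (hxy k))
    exact ⟨fun g => by rw [← hf, f.map_fun], fun R => (f.map_rel R x).symm⟩
  · rintro ⟨hsub, h⟩
    exact ⟨{ toFun := Set.inclusion hsub
             inj' := Set.inclusion_injective hsub
             map_fun' := fun g x => Subtype.ext ((h _ x _ fun _ => rfl).1 g)
             map_rel' := fun R x => ((h _ x _ fun _ => rfl).2 R).symm }, fun _ => rfl⟩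

theorem Sub.subset {M N : SubStruct L τ} (h : M.Sub N) : M.carrier ⊆ N.carrier :=
  (sub_iff.1 h).1

theorem Sub.trans {M N P : SubStruct L τ} (h : M.Sub N) (h' : N.Sub P) : M.Sub P := by
  obtain ⟨f, hf⟩ := h
  obtain ⟨g, hg⟩ := h'
  exact ⟨g.comp f, fun x => by simp [hf, hg]⟩

/-- Two substructures of the same structure are comparable as soon as their carriers are. -/
theorem Sub.of_subset {M N P : SubStruct L τ} (hM : M.Sub P) (hN : N.Sub P)
    (h : M.carrier ⊆ N.carrier) : M.Sub N := by
  refine sub_iff.2 ⟨h, fun n x y hxy => ?_⟩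
  have hx := (sub_iff.1 hM).2 n x (fun k => ⟨x k, hM.subset (x k).2⟩) fun _ => rfl
  have hy := (sub_iff.1 hN).2 n y (fun k => ⟨x k, hM.subset (x k).2⟩) fun k => (hxy k).symm
  exact ⟨fun f => (hx.1 f).trans (hy.1 f).symm, fun R => (hx.2 R).trans (hy.2 R).symm⟩

theorem Sub.eq_of_carrier_eq {M N : SubStruct L τ} (h : M.Sub N) (hc : M.carrier = N.carrier) :
    M = N := by
  obtain ⟨C, s⟩ := M
  obtain ⟨C', s'⟩ := N
  obtain rfl : C = C' := hc
  have h' := (sub_iff.1 h).2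
  congr 1
  ext n f x
  · exact congrArg Subtype.val (Subtype.ext ((h' n x x fun _ => rfl).1 f))
  · exact (h' n x x fun _ => rfl).2 f

end SubStruct

/-- The language with function symbols of each positive arity indexed by `ι`, and with no
constants and no relation symbols. -/
def hullLanguage (ι : Type u) : FirstOrder.Language.{u, u} where
  Functions
    | 0 => PEmpty
    | _ + 1 => ι
  Relations _ := PEmpty

namespace hullLanguage

variable {ι : Type u}

/-- The function symbol of arity `n + 1` with index `i`. -/
def symb (n : ℕ) (i : ι) : (hullLanguage ι).Functions (n + 1) := i

instance (n : ℕ) : IsEmpty ((hullLanguage ι).Relations n) := inferInstanceAs (IsEmpty PEmpty)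

theorem card_le {χ : Cardinal.{u}} (hχ : ℵ₀ ≤ χ) (hι : #ι ≤ χ) : (hullLanguage ι).card ≤ χ := by
  rw [card_eq_card_functions_add_card_relations]
  have h (n : ℕ) : #((hullLanguage ι).Functions n) ≤ χ := by
    cases n with
    | zero => exact (mk_eq_zero PEmpty).trans_le zero_le
    | succ n => exact hι
  have h' (n : ℕ) : #((hullLanguage ι).Relations n) = 0 := mk_eq_zero _
  simp only [h', Cardinal.lift_zero, Cardinal.sum_const, mul_zero, add_zero, Cardinal.lift_id]
  refine (Cardinal.sum_le_sum _ (fun _ => χ) fun n => ?_).trans ?_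
  · simpa using h n
  · simpa using mul_le_of_le hχ hχ le_rfl

/-- The set of values at the tuple `a` of all function symbols of the appropriate arity. -/
def hull (ι : Type u) (M : SubStruct L τ) [(hullLanguage ι).Structure M.carrier] {n : ℕ}
    (a : Fin (n + 1) → M.carrier) : Set τ :=
  Set.range fun i : ι => ((funMap (symb n i) a : M.carrier) : τ)

/-- The term applying the function symbol with index `i` to the variables selected by `σ`. -/
def hullTerm (L : FirstOrder.Language.{u, u}) {m n : ℕ} (i : ι) (σ : Fin (n + 1) → Fin m) :
    (L.sum (hullLanguage ι)).Term (Fin m) :=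
  Term.func (Sum.inr (symb n i) : (L.sum (hullLanguage ι)).Functions (n + 1))
    fun k => Term.var (σ k)

@[simp]
theorem realize_hullTerm {M : SubStruct L τ} [(hullLanguage ι).Structure M.carrier] {m n : ℕ}
    (i : ι) (σ : Fin (n + 1) → Fin m) (a : Fin m → M.carrier) :
    (hullTerm L i σ).realize a = funMap (symb n i) (a ∘ σ) :=
  rfl

/-- An expansion of `N` for which the hulls of tuples form a monotone system of strong
submodels of `N`. -/
def IsHullExpansion (K : Set (SubStruct L τ)) (lei : SubStruct L τ → SubStruct L τ → Prop)
    (ι : Type u) (N : SubStruct L τ) [(hullLanguage ι).Structure N.carrier] : Prop :=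
  ∃ G : Finset N.carrier → SubStruct L τ,
    (∀ s, G s ∈ K ∧ lei (G s) N ∧ ∀ x ∈ s, (x : τ) ∈ (G s).carrier) ∧
      (∀ s t, s ⊆ t → (G s).carrier ⊆ (G t).carrier) ∧
        ∀ (n : ℕ) (a : Fin (n + 1) → N.carrier),
          (G (Set.finite_range a).toFinset).carrier = hull ι N a

end hullLanguage

open hullLanguage

/-- Every member of `K` is the union of a monotone system, indexed by its finite subsets, of
strong submodels of size at most `χ`. -/
theorem IsAEC.exists_finset_system {K : Set (SubStruct L τ)}
    {lei : SubStruct L τ → SubStruct L τ → Prop} (haec : IsAEC K lei) {χ : Cardinal.{u}}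
    (hwit : IsLSWitness K lei χ) {N : SubStruct L τ} (hN : N ∈ K) :
    ∃ G : Finset N.carrier → SubStruct L τ,
      (∀ s, G s ∈ K ∧ lei (G s) N ∧ (∀ x ∈ s, (x : τ) ∈ (G s).carrier) ∧ #(G s).carrier ≤ χ) ∧
        ∀ s t, s ⊆ t → (G s).carrier ⊆ (G t).carrier := by
  have hχ : ℵ₀ ≤ χ := le_add_self.trans hwit.1
  have hex : ∀ A : Set τ, ∃ P : SubStruct L τ, A ⊆ N.carrier →
      P ∈ K ∧ lei P N ∧ A ⊆ P.carrier ∧ #P.carrier ≤ #A + χ := fun A => by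
    by_cases hA : A ⊆ N.carrier
    · obtain ⟨P, hP⟩ := hwit.2 N hN A hA
      exact ⟨P, fun _ => hP⟩
    · exact ⟨N, fun h => absurd h hA⟩
  choose c hc using hex
  let A (s : Finset N.carrier) (H : ∀ t ⊂ s, SubStruct L τ) : Set τ :=
    Subtype.val '' (s : Set N.carrier) ∪ ⋃ t : {t // t ⊂ s}, (H t t.2).carrier
  let G : Finset N.carrier → SubStruct L τ := Finset.strongInduction fun s H => c (A s H)
  have hG (s) : G s = c (A s fun t _ => G t) := Finset.strongInduction_eq _ s
  have hA_sub (s : Finset N.carrier)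
      (hs : ∀ t ⊂ s, (G t).carrier ⊆ N.carrier) : A s (fun t _ => G t) ⊆ N.carrier := by
    refine Set.union_subset ?_ (Set.iUnion_subset fun t => hs t t.2)
    rintro _ ⟨x, -, rfl⟩
    exact x.2
  have key (s) : G s ∈ K ∧ lei (G s) N ∧ A s (fun t _ => G t) ⊆ (G s).carrier ∧
      #(G s).carrier ≤ χ := by
    induction s using Finset.strongInduction with
    | H s ih =>
      obtain ⟨h₁, h₂, h₃, h₄⟩ := hc _ (hA_sub s fun t ht =>
        (haec.sub_of_lei _ _ (ih t ht).1 hN (ih t ht).2.1).subset)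
      rw [← hG] at h₁ h₂ h₃ h₄
      refine ⟨h₁, h₂, h₃, h₄.trans (add_le_of_le hχ ?_ le_rfl)⟩
      refine (mk_union_le _ _).trans (add_le_of_le hχ ?_ ?_)
      · exact (s.finite_toSet.image _).lt_aleph0.le.trans hχ
      · refine (mk_iUnion_le _).trans (mul_le_of_le hχ ?_ ?_)
        · have : Finite {t // t ⊂ s} := (s.finite_toSet.finite_subsets.preimage
            Finset.coe_injective.injOn).subset fun t (ht : t ⊂ s) => by
              simpa using ht.subset
          exact (lt_aleph0_of_finite _).le.trans hχ
        · exact ciSup_le' fun t => (ih t t.2).2.2.2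
  refine ⟨G, fun s => ⟨(key s).1, (key s).2.1, fun x hx =>
    (key s).2.2.1 (Or.inl ⟨x, hx, rfl⟩), (key s).2.2.2⟩, fun s t hst => ?_⟩
  rcases hst.eq_or_ssubset with rfl | hst
  · exact le_rfl
  · exact (Set.subset_iUnion (fun t' : {t' // t' ⊂ t} => (G t').carrier) ⟨s, hst⟩).trans
      (Set.subset_union_right.trans (key t).2.2.1)

theorem IsAEC.exists_isHullExpansion {K : Set (SubStruct L τ)}
    {lei : SubStruct L τ → SubStruct L τ → Prop} (haec : IsAEC K lei) {ι : Type u}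
    (hwit : IsLSWitness K lei #ι) {N : SubStruct L τ} (hN : N ∈ K) :
    ∃ str' : (hullLanguage ι).Structure N.carrier,
      letI := str'
      IsHullExpansion K lei ι N := by
  obtain ⟨G, hG, hmono⟩ := haec.exists_finset_system hwit hN
  have hex (n : ℕ) (a : Fin (n + 1) → N.carrier) : ∃ g : ι → N.carrier,
      Set.range (fun i => (g i : τ)) = (G (Set.finite_range a).toFinset).carrier := by
    obtain ⟨h₁, h₂, h₃, h₄⟩ := hG (Set.finite_range a).toFinset
    obtain ⟨e⟩ := h₄
    have : Nonempty (G (Set.finite_range a).toFinset).carrier := ⟨⟨a 0, h₃ _ (by simp)⟩⟩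
    have hsurj := Function.invFun_surjective e.injective
    refine ⟨fun i => ⟨(Function.invFun e i : (G (Set.finite_range a).toFinset).carrier),
      (haec.sub_of_lei _ _ h₁ hN h₂).subset (Function.invFun e i).2⟩, ?_⟩
    ext x
    constructor
    · rintro ⟨i, rfl⟩
      exact (Function.invFun e i).2
    · intro hx
      obtain ⟨i, hi⟩ := hsurj ⟨x, hx⟩
      exact ⟨i, congrArg Subtype.val hi⟩
  choose g hg using hex
  refine ⟨{ funMap := fun {n} => match n with
              | 0 => fun f _ => PEmpty.elim f
              | n + 1 => fun i a => g n a i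
            RelMap := fun R _ => PEmpty.elim R }, G, fun s => ⟨(hG s).1, (hG s).2.1, (hG s).2.2.1⟩,
    hmono, fun n a => (hg n a).symm⟩

theorem Set.exists_range_equiv_range {ι α β : Type*} {g : ι → α} {h : ι → β}
    (H : ∀ i j, g i = g j ↔ h i = h j) :
    ∃ e : Set.range g ≃ Set.range h, ∀ i, e ⟨g i, i, rfl⟩ = ⟨h i, i, rfl⟩ := by
  have hval (i : ι) : h (Exists.choose (⟨i, rfl⟩ : g i ∈ Set.range g)) = h i :=
    (H _ _).1 (Exists.choose_spec (⟨i, rfl⟩ : g i ∈ Set.range g))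
  refine ⟨Equiv.ofBijective (fun x => ⟨h x.2.choose, _, rfl⟩) ⟨?_, ?_⟩, fun i =>
    Subtype.ext (hval i)⟩
  · rintro ⟨_, i, rfl⟩ ⟨_, j, rfl⟩ hij
    have := congrArg Subtype.val hij
    simp only [hval] at this
    exact Subtype.ext ((H _ _).2 this)
  · rintro ⟨_, i, rfl⟩
    exact ⟨⟨g i, i, rfl⟩, Subtype.ext (hval i)⟩

/-- If a tuple of `M` has the same type as a tuple of a hull expansion of a member of `K`, then
its hull is the carrier of a member of `K`, in which the hulls of subtuples are strong submodels. -/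
theorem IsAEC.exists_carrier_eq_hull {K : Set (SubStruct L τ)}
    {lei : SubStruct L τ → SubStruct L τ → Prop} (haec : IsAEC K lei) {ι : Type u}
    {M N : SubStruct L τ} [(hullLanguage ι).Structure M.carrier]
    [(hullLanguage ι).Structure N.carrier] (hN : N ∈ K) (hexp : IsHullExpansion K lei ι N)
    {m : ℕ} {b : Fin (m + 1) → M.carrier} {b' : Fin (m + 1) → N.carrier}
    (hb : ∀ φ : (L.sum (hullLanguage ι)).Formula (Fin (m + 1)), φ.Realize b ↔ φ.Realize b') :
    ∃ P ∈ K, P.carrier = hull ι M b ∧ P.Sub M ∧ (∀ k, (b k : τ) ∈ P.carrier) ∧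
      ∀ (n : ℕ) (σ : Fin (n + 1) → Fin (m + 1)),
        ∃ Q ∈ K, Q.carrier = hull ι M (b ∘ σ) ∧ lei Q P := by
  obtain ⟨G, hG, hmono, hhull⟩ := hexp
  have hterm (t s : (L.sum (hullLanguage ι)).Term (Fin (m + 1))) :
      t.realize b = s.realize b ↔ t.realize b' = s.realize b' := by
    simpa using hb (t.equal s)
  set P' := G (Set.finite_range b').toFinset
  obtain ⟨hP'K, hP'N, hbP'⟩ := hG (Set.finite_range b').toFinset
  have hP'sub : P'.Sub N := haec.sub_of_lei _ _ hP'K hN hP'N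
  have hP'c : P'.carrier = hull ι N b' := hhull m b'
  obtain ⟨e, he⟩ : ∃ e : P'.carrier ≃ hull ι M b, ∀ (i : ι) (h : _),
      e ⟨(funMap (symb m i) b' : N.carrier), h⟩ = ⟨(funMap (symb m i) b : M.carrier), i, rfl⟩ := by
    rw [hP'c]
    obtain ⟨e, he⟩ := Set.exists_range_equiv_range
      (g := fun i : ι => ((funMap (symb m i) b' : N.carrier) : τ))
      (h := fun i : ι => ((funMap (symb m i) b : M.carrier) : τ)) fun i j => by
        simpa [Subtype.ext_iff] using (hterm (hullTerm L i id) (hullTerm L j id)).symm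
    exact ⟨e, fun i _ => he i⟩
  have hidx (y : P'.carrier) : ∃ i : ι, (y : τ) = (funMap (symb m i) b' : N.carrier) := by
    obtain ⟨i, hi⟩ : (y : τ) ∈ hull ι N b' := hP'c ▸ y.2
    exact ⟨i, hi.symm⟩
  -- The equivalence `e` commutes with all terms taking values in its domain.
  have hev (t : (L.sum (hullLanguage ι)).Term (Fin (m + 1))) (y : P'.carrier)
      (hy : (y : τ) = t.realize b') : (e y : τ) = t.realize b := by
    obtain ⟨i, hi⟩ := hidx y
    have h : y = ⟨(funMap (symb m i) b' : N.carrier), hi ▸ y.2⟩ := Subtype.ext hi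
    rw [h, he]
    exact congrArg Subtype.val ((hterm (hullTerm L i id) t).2 (Subtype.ext (hi.symm.trans hy)))
  obtain ⟨P, E, hPc, hE⟩ : ∃ (P : SubStruct L τ) (E : P'.carrier ≃[L] P.carrier),
      P.carrier = hull ι M b ∧ ∀ y, (E y : τ) = e y :=
    ⟨⟨hull ι M b, e.inducedStructure⟩, e.inducedStructureEquiv, rfl, fun _ => rfl⟩
  obtain ⟨hPK, hPlei⟩ := haec.iso_closed P' P E hP'K
  have hPsub : P.Sub M := by
    refine SubStruct.sub_iff.2 ⟨?_, fun n x y hxy => ?_⟩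
    · rw [hPc]
      rintro _ ⟨i, rfl⟩
      exact (funMap (symb m i) b).2
    choose i hi using fun k => hidx (E.symm (x k))
    have hy : y = fun k => (hullTerm L (i k) id).realize b := funext fun k => Subtype.ext <| by
      rw [← hxy k, ← hev (hullTerm L (i k) id) (E.symm (x k)) (hi k), ← hE, E.apply_symm_apply]
    have hx : E ∘ (E.symm ∘ x) = x := by ext; simp
    have hsub := (SubStruct.sub_iff.1 hP'sub).2 n (E.symm ∘ x)
      (fun k => (hullTerm L (i k) id).realize b') hi
    refine ⟨fun f => ?_, fun R => ?_⟩
    · rw [← hx, ← E.map_fun, hE, hy]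
      exact hev (Term.func (Sum.inl f : (L.sum (hullLanguage ι)).Functions n)
        fun k => hullTerm L (i k) id) _ (hsub.1 f)
    · rw [← hx, E.map_rel, hsub.2, hy]
      exact Formula.realize_rel.symm.trans ((hb (Relations.formula
        (Sum.inl R : (L.sum (hullLanguage ι)).Relations n)
        fun k => hullTerm L (i k) id)).symm.trans Formula.realize_rel)
  refine ⟨P, hPK, hPc, hPsub, fun k => ?_, fun n σ => ?_⟩
  · have hk := hev (Term.var k) ⟨b' k, hbP' _ (by simp)⟩ rfl
    rw [← hE, Term.realize_var] at hk
    exact hk ▸ (E _).2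
  · obtain ⟨hQK, hQN, -⟩ := hG (Set.finite_range (b' ∘ σ)).toFinset
    have hsub : (G (Set.finite_range (b' ∘ σ)).toFinset).carrier ⊆ P'.carrier :=
      hmono _ _ (by simpa using Set.range_comp_subset_range σ b')
    obtain ⟨Q, hQ, hQP, hQc⟩ := hPlei _ hQK <| haec.coherence _ _ _ hQK hP'K hN hQN hP'N <|
      (haec.sub_of_lei _ _ hQK hN hQN).of_subset hP'sub hsub
    refine ⟨Q, hQ, ?_, hQP⟩
    rw [hQc, hhull n (b' ∘ σ)]
    rw [hhull n (b' ∘ σ)] at hsub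
    ext z
    constructor
    · rintro ⟨y, ⟨i, hi⟩, rfl⟩
      exact ⟨i, ((hE y).trans (hev (hullTerm L i σ) y hi.symm)).symm⟩
    · rintro ⟨i, rfl⟩
      exact ⟨⟨_, hsub ⟨i, rfl⟩⟩, ⟨i, rfl⟩, (hE _).trans (hev (hullTerm L i σ) _ rfl)⟩

/-- A nonempty structure all of whose tuples have types realized in hull expansions of members of
`K` is the directed union of the hulls of its tuples, hence belongs to `K`. -/
theorem IsAEC.mem_of_types_realized {K : Set (SubStruct L τ)}
    {lei : SubStruct L τ → SubStruct L τ → Prop} (haec : IsAEC K lei) {ι : Type u}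
    {M : SubStruct L τ} [(hullLanguage ι).Structure M.carrier] [Nonempty M.carrier]
    (hM : ∀ (n : ℕ) (b : Fin (n + 1) → M.carrier), ∃ N ∈ K,
      ∃ str' : (hullLanguage ι).Structure N.carrier,
        letI := str'
        IsHullExpansion K lei ι N ∧ ∃ b' : Fin (n + 1) → N.carrier,
          ∀ φ : (L.sum (hullLanguage ι)).Formula (Fin (n + 1)), φ.Realize b ↔ φ.Realize b') :
    M ∈ K := by
  have hex (a : Σ n : ℕ, Fin (n + 1) → M.carrier) :
      ∃ P ∈ K, P.carrier = hull ι M a.2 ∧ P.Sub M ∧ (∀ k, (a.2 k : τ) ∈ P.carrier) ∧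
        ∀ (n : ℕ) (σ : Fin (n + 1) → Fin (a.1 + 1)),
          ∃ Q ∈ K, Q.carrier = hull ι M (a.2 ∘ σ) ∧ lei Q P := by
    obtain ⟨N, hN, str', hexp, b', hb⟩ := hM a.1 a.2
    exact haec.exists_carrier_eq_hull hN hexp hb
  choose D hDK hDc hDM hmem hlei using hex
  let _ : Preorder (Σ n : ℕ, Fin (n + 1) → M.carrier) := Preorder.lift fun a => Set.range a.2
  have htuple (s : Set M.carrier) (hs : s.Finite) :
      ∃ a : Σ n : ℕ, Fin (n + 1) → M.carrier, s ⊆ Set.range a.2 := by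
    obtain ⟨x₀⟩ := ‹Nonempty M.carrier›
    obtain ⟨n, f, hf⟩ := hs.fin_param
    exact ⟨⟨n, Fin.cons x₀ f⟩, by
      rw [← hf.2, Fin.range_cons]
      exact Set.subset_insert _ _⟩
  obtain ⟨Un, hUn, hUnc, hDUn, -⟩ := haec.tarskiVaught (Σ n : ℕ, Fin (n + 1) → M.carrier) D
    ((htuple ∅ Set.finite_empty).nonempty)
    (fun a b => by
      obtain ⟨c, hc⟩ := htuple _ ((Set.finite_range a.2).union (Set.finite_range b.2))
      exact ⟨c, Set.subset_union_left.trans hc, Set.subset_union_right.trans hc⟩)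
    hDK (by
      rintro ⟨n, a⟩ b hab
      obtain ⟨σ, rfl⟩ : ∃ σ : Fin (n + 1) → Fin (b.1 + 1), b.2 ∘ σ = a := by
        choose σ hσ using fun k => hab (Set.mem_range_self k)
        exact ⟨σ, funext hσ⟩
      obtain ⟨Q, hQ, hQc, hQb⟩ := hlei b n σ
      have hQM : Q.Sub M := (haec.sub_of_lei _ _ hQ (hDK b) hQb).trans (hDM b)
      have hc : Q.carrier = (D ⟨n, b.2 ∘ σ⟩).carrier := hQc.trans (hDc ⟨n, b.2 ∘ σ⟩).symm
      rwa [← (hQM.of_subset (hDM ⟨n, b.2 ∘ σ⟩) hc.subset).eq_of_carrier_eq hc])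
  have hDsub (a) : (D a).Sub Un := haec.sub_of_lei _ _ (hDK a) hUn (hDUn a)
  have hc : Un.carrier = M.carrier := by
    rw [hUnc]
    refine (Set.iUnion_subset fun a => (hDM a).subset).antisymm fun x hx => ?_
    exact Set.mem_iUnion.2 ⟨⟨0, fun _ => ⟨x, hx⟩⟩, hmem ⟨0, fun _ => ⟨x, hx⟩⟩ 0⟩
  suffices h : Un.Sub M by rwa [← h.eq_of_carrier_eq hc]
  refine SubStruct.sub_iff.2 ⟨hc.subset, fun n x y hxy => ?_⟩
  obtain ⟨a, ha⟩ := htuple _ (Set.finite_range y)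
  have hya (k) : (y k : τ) ∈ (D a).carrier := by
    obtain ⟨j, hj⟩ := ha (Set.mem_range_self k)
    exact hj ▸ hmem a j
  have h₁ := (SubStruct.sub_iff.1 (hDsub a)).2 n (fun k => ⟨y k, hya k⟩) x fun k => (hxy k).symm
  have h₂ := (SubStruct.sub_iff.1 (hDM a)).2 n (fun k => ⟨y k, hya k⟩) y fun k => rfl
  exact ⟨fun f => (h₁.1 f).symm.trans (h₂.1 f), fun R => (h₁.2 R).symm.trans (h₂.2 R)⟩

/-- An empty structure belongs to `K` as soon as it is elementarily equivalent to an expansion of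
a member of `K`. -/
theorem IsAEC.mem_of_isEmpty {K : Set (SubStruct L τ)}
    {lei : SubStruct L τ → SubStruct L τ → Prop} (haec : IsAEC K lei)
    {L' : FirstOrder.Language.{u, u}} {M N : SubStruct L τ} [L'.Structure M.carrier]
    [L'.Structure N.carrier] [IsEmpty M.carrier] (hN : N ∈ K) {b : Fin 0 → M.carrier}
    {b' : Fin 0 → N.carrier}
    (hb : ∀ φ : (L.sum L').Formula (Fin 0), φ.Realize b ↔ φ.Realize b') : M ∈ K := by
  have hNe : IsEmpty N.carrier := by
    let φ : (L.sum L').Formula (Fin 0) := BoundedFormula.all (⊥ : (L.sum L').BoundedFormula _ 1)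
    have hφ : φ.Realize b := fun x => isEmptyElim x
    exact ⟨fun x => (hb φ).1 hφ x⟩
  refine (haec.iso_closed N M
    { toEquiv := Equiv.equivOfIsEmpty _ _
      map_fun' := fun f x => isEmptyElim (funMap f x)
      map_rel' := fun {n} R x => ?_ } hN).1
  cases n with
  | succ n => exact isEmptyElim (x 0)
  | zero =>
    have h := Formula.realize_rel.symm.trans ((hb (Relations.formula
      (Sum.inl R : (L.sum L').Relations 0) Fin.elim0)).trans Formula.realize_rel)
    rw [relMap_sumInl, relMap_sumInl] at h
    convert h using 2

theorem FirstOrder.Language.mk_set_sigma_set_formula_le {L : FirstOrder.Language.{u, u}}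
    {χ : Cardinal.{u}} (hχ : ℵ₀ ≤ χ) (hL : L.card ≤ χ)
    (Γ : Set (Σ n : ℕ, Set (L.Formula (Fin n)))) : #Γ ≤ 2 ^ χ := by
  have hχ' : ℵ₀ ≤ 2 ^ χ := hχ.trans (cantor χ).le
  have hF (n : ℕ) : #(L.Formula (Fin n)) ≤ χ := by
    refine (mk_le_of_injective (f := fun φ => (⟨0, φ⟩ : Σ k, L.BoundedFormula (Fin n) k))
      sigma_mk_injective).trans (BoundedFormula.card_le.trans (max_le hχ ?_))
    refine add_le_of_le hχ ?_ (by simpa using hL)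
    simpa using natCast_lt_aleph0.le.trans hχ
  refine (mk_set_le Γ).trans ?_
  rw [mk_sigma]
  refine (Cardinal.sum_le_sum _ (fun _ => 2 ^ χ) fun n => ?_).trans ?_
  · rw [mk_set]
    exact power_le_power_left two_ne_zero (hF n)
  · simpa using mul_le_of_le hχ' hχ' le_rfl

/-- **Shelah's Presentation Theorem.** Let `(K, ≤K)` be an AEC in a
finitary first-order language `L` with `LS(K) = χ`. Then there are: a language
`L₁ = L.sum L'` obtained from `L` by adding at most `χ` new function symbols (and no
relation symbols); an `L₁`-theory `T₁` with `|T₁| ≤ χ`; and a set `Γ` of at most `2^χ`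
partial types (sets of `L₁`-formulas in a fixed finite tuple of free variables), such
that `K` is the class of `L`-reducts of `L₁`-structures modeling `T₁` and omitting every
`p ∈ Γ`; equivalently, `M ∈ K` iff `M` admits an expansion to an `L₁`-structure
modeling `T₁` and omitting every `p ∈ Γ`. -/
theorem statement0 (K : Set (SubStruct L τ))
    (lei : SubStruct L τ → SubStruct L τ → Prop) (haec : IsAEC K lei)
    (χ : Cardinal.{u}) (hwit : IsLSWitness K lei χ)
    (hmin : ∀ lam' : Cardinal.{u}, IsLSWitness K lei lam' → χ ≤ lam') :
    ∃ (L' : FirstOrder.Language.{u, u}) (T₁ : (L.sum L').Theory)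
      (Γ : Set (Σ n : ℕ, Set ((L.sum L').Formula (Fin n)))),
      (∀ n, IsEmpty (L'.Relations n)) ∧ L'.card ≤ χ ∧ #T₁ ≤ χ ∧ #Γ ≤ 2 ^ χ ∧
        ∀ M : SubStruct L τ,
          M ∈ K ↔
            ∃ str' : L'.Structure M.carrier,
              letI := str'
              (∀ φ ∈ T₁, FirstOrder.Language.Sentence.Realize (↥M.carrier) φ) ∧
                ∀ p ∈ Γ, ¬ ∃ v : Fin p.1 → M.carrier,
                  ∀ φ ∈ p.2, FirstOrder.Language.Formula.Realize φ v := by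
  have hχ : ℵ₀ ≤ χ := le_add_self.trans hwit.1
  have hout : #χ.out = χ := mk_out χ
  have hcard : (hullLanguage χ.out).card ≤ χ := hullLanguage.card_le hχ hout.le
  let Γ : Set (Σ n : ℕ, Set ((L.sum (hullLanguage χ.out)).Formula (Fin n))) :=
    {p | ∀ N ∈ K, ∀ str' : (hullLanguage χ.out).Structure N.carrier,
      letI := str'
      IsHullExpansion K lei χ.out N →
        ¬ ∃ v : Fin p.1 → N.carrier, ∀ φ ∈ p.2, Formula.Realize φ v}
  refine ⟨hullLanguage χ.out, ∅, Γ, inferInstance, hcard, by simp,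
    mk_set_sigma_set_formula_le hχ ?_ Γ, fun M => ⟨fun hM => ?_, ?_⟩⟩
  · rw [card_sum, Cardinal.lift_id, Cardinal.lift_id]
    exact add_le_of_le hχ (le_self_add.trans hwit.1) hcard
  · obtain ⟨str', hstr'⟩ := haec.exists_isHullExpansion (hout.symm ▸ hwit) hM
    exact ⟨str', by simp, fun p hp => hp M hM str' hstr'⟩
  · rintro ⟨str', -, hΓ⟩
    have hreal (n : ℕ) (b : Fin n → M.carrier) : ∃ N ∈ K,
        ∃ str' : (hullLanguage χ.out).Structure N.carrier,
          letI := str'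
          IsHullExpansion K lei χ.out N ∧ ∃ b' : Fin n → N.carrier,
            ∀ φ : (L.sum (hullLanguage χ.out)).Formula (Fin n),
              φ.Realize b ↔ φ.Realize b' := by
      by_contra hcon
      refine hΓ ⟨n, {φ | φ.Realize b}⟩ (fun N hN strN hexp hv => hcon ?_) ⟨b, fun _ hφ => hφ⟩
      obtain ⟨v, hv⟩ := hv
      refine ⟨N, hN, strN, hexp, v, fun φ => ⟨hv φ, fun h => ?_⟩⟩
      by_contra hφ
      exact Formula.realize_not.1 (hv φ.not (Formula.realize_not.2 hφ)) h
    rcases isEmpty_or_nonempty M.carrier with hemp | hne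
    · obtain ⟨N, hN, strN, -, b', hb⟩ := hreal 0 Fin.elim0
      exact haec.mem_of_isEmpty hN hb
    · exact haec.mem_of_types_realized fun n => hreal (n + 1)
end

section
/- Let L be a finitary first-order language and κ an infinite cardinal with κ ≥ |L|. In the category Emb(L), whose objects are all L-structures and whose morphisms are the L-embeddings, a structure M is κ⁺-presentable if and only if |M| ≤ κ. -/
universe u

open FirstOrder Cardinal CategoryTheory

/-- A preorder is `θ`-directed if every subset of cardinality `< θ` has an upper bound. -/
def IsMuDirected (θ : Cardinal.{u}) (J : Type u) [Preorder J] : Prop :=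
  ∀ s : Set J, #s < θ → ∃ ub : J, ∀ j ∈ s, j ≤ ub

/-- An object `M` of a category `C` is `θ`-presentable if its hom-functor
`Hom_C(M, −) : C → Set` preserves colimits of `θ`-directed diagrams. -/
def IsPresentable (θ : Cardinal.{u}) {C : Type*} [Category.{u} C] (M : C) : Prop :=
  ∀ (J : Type u) [Preorder J], IsMuDirected θ J →
    Nonempty (Limits.PreservesColimitsOfShape J (coyoneda.obj (Opposite.op M)))

/-- An object of `Emb(L)` : a bundled `L`-structure. -/
structure EmbObj (L : FirstOrder.Language.{u, u}) : Type (u + 1) where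
  carrier : Type u
  str : L.Structure carrier

attribute [instance] EmbObj.str

/-- `Emb(L)` : the category of all `L`-structures and `L`-embeddings. -/
instance embCat (L : FirstOrder.Language.{u, u}) : Category.{u} (EmbObj L) where
  Hom M N := M.carrier ↪[L] N.carrier
  id M := FirstOrder.Language.Embedding.refl L M.carrier
  comp f g := g.comp f
  id_comp f := FirstOrder.Language.Embedding.ext fun x => rfl
  comp_id f := FirstOrder.Language.Embedding.ext fun x => rfl
  assoc f g h := FirstOrder.Language.Embedding.ext fun x => rfl

open FirstOrder.Language Limits

theorem IsMuDirected.exists_ub {κ : Cardinal.{u}} {J : Type u} [Preorder J]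
    (hJ : IsMuDirected (Order.succ κ) J) {ι : Type u} (hι : #ι ≤ κ) (j : ι → J) :
    ∃ ub, ∀ i, j i ≤ ub := by
  obtain ⟨ub, h⟩ := hJ (Set.range j) (Order.lt_succ_of_le (mk_range_le.trans hι))
  exact ⟨ub, fun i => h _ ⟨i, rfl⟩⟩

theorem IsMuDirected.exists_ub_of_finite {κ : Cardinal.{u}} (hκ : ℵ₀ ≤ κ) {J : Type u} [Preorder J]
    (hJ : IsMuDirected (Order.succ κ) J) {ι : Type*} [Finite ι] (j : ι → J) :
    ∃ ub, ∀ i, j i ≤ ub := by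
  obtain ⟨ub, h⟩ := hJ (Set.range j)
    ((lt_aleph0_of_finite _).trans_le (hκ.trans (Order.le_succ κ)))
  exact ⟨ub, fun i => h _ ⟨i, rfl⟩⟩

namespace EmbObj

variable {L : FirstOrder.Language.{u, u}}

/-- The embedding of structures underlying a morphism of `Emb(L)`. -/
def toEmb {M N : EmbObj L} (f : M ⟶ N) : M.carrier ↪[L] N.carrier := f

theorem hom_ext {M N : EmbObj L} {f g : M ⟶ N} (h : ∀ x, toEmb f x = toEmb g x) : f = g :=
  FirstOrder.Language.Embedding.ext h

theorem cancel_right {M N P : EmbObj L} {f g : M ⟶ N} (h : N ⟶ P) (hfg : f ≫ h = g ≫ h) :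
    f = g :=
  hom_ext fun x => (toEmb h).injective (congrArg (fun k => toEmb k x) hfg)

theorem toEmb_ι_map {J : Type u} [Preorder J] {F : J ⥤ EmbObj L} (c : Cocone F) {i j : J}
    (h : i ≤ j) (x : (F.obj i).carrier) :
    toEmb (c.ι.app j) (toEmb (F.map (homOfLE h)) x) = toEmb (c.ι.app i) x :=
  congrArg (fun k => toEmb k x) (c.w (homOfLE h))

/-- A map whose image lies in the image of an embedding factors through it. -/
theorem exists_factor {M N P : EmbObj L} (f : M ⟶ P) (g : N ⟶ P)
    (h : ∀ x, ∃ y, toEmb g y = toEmb f x) : ∃ k : M ⟶ N, k ≫ g = f := by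
  let e := (toEmb g).equivRange
  have hr : ∀ x, toEmb f x ∈ (toEmb g).toHom.range := fun x => h x
  let k : M.carrier ↪[L] N.carrier :=
    e.symm.toEmbedding.comp (Embedding.codRestrict _ (toEmb f) hr)
  refine ⟨k, hom_ext fun x => ?_⟩
  have := (toEmb g).equivRange_apply (k x)
  refine this.symm.trans ?_
  have h2 : e (k x) = ⟨toEmb f x, hr x⟩ := e.apply_symm_apply _
  exact congrArg Subtype.val h2

section Union

variable {κ : Cardinal.{u}} (hκ : ℵ₀ ≤ κ) {J : Type u} [Preorder J]
  (hJ : IsMuDirected (Order.succ κ) J) {F : J ⥤ EmbObj L} (c : Cocone F)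

/-- The union of the images of the legs of a cocone over a directed diagram. -/
def unionSub : L.Substructure c.pt.carrier where
  carrier := {x | ∃ j y, toEmb (c.ι.app j) y = x}
  fun_mem {n} f x hx := by
    choose j y hy using hx
    obtain ⟨k, hk⟩ := hJ.exists_ub_of_finite hκ j
    refine ⟨k, Structure.funMap f fun i => toEmb (F.map (homOfLE (hk i))) (y i), ?_⟩
    rw [Embedding.map_fun]
    congr 1
    funext i
    exact (toEmb_ι_map c (hk i) (y i)).trans (hy i)

/-- The cocone obtained by restricting the codomain to the union of the images. -/
def unionCocone : Cocone F where
  pt := ⟨unionSub hκ hJ c, inferInstance⟩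
  ι :=
    { app j := Embedding.codRestrict (unionSub hκ hJ c) (toEmb (c.ι.app j)) fun y => ⟨j, y, rfl⟩
      naturality _ _ h := hom_ext fun x => Subtype.ext (toEmb_ι_map c (leOfHom h) x) }

include hκ hJ in
theorem exists_rep (hc : IsColimit c) (x : c.pt.carrier) : ∃ j y, toEmb (c.ι.app j) y = x := by
  let i : (unionCocone hκ hJ c).pt ⟶ c.pt := (unionSub hκ hJ c).subtype
  have h : hc.desc (unionCocone hκ hJ c) ≫ i = 𝟙 _ := hc.hom_ext fun j => by
    rw [hc.fac_assoc, Category.comp_id]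
    rfl
  have hx : toEmb i (toEmb (hc.desc (unionCocone hκ hJ c)) x) = x :=
    congrArg (fun k => toEmb k x) h
  obtain ⟨j, y, hy⟩ := (toEmb (hc.desc (unionCocone hκ hJ c)) x).2
  exact ⟨j, y, hy.trans hx⟩

end Union

theorem isPresentable_of_card_le {κ : Cardinal.{u}} (hκ : ℵ₀ ≤ κ) {M : EmbObj L}
    (hM : #M.carrier ≤ κ) : IsPresentable (Order.succ κ) M := by
  refine fun J _ hJ => ⟨⟨fun {F} => ⟨fun {c} hc => ⟨?_⟩⟩⟩⟩
  refine Types.FilteredColimit.isColimitOf _ _ (fun f => ?_) (fun i j g g' h => ?_)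
  · change M ⟶ c.pt at f
    choose j y hy using fun x => exists_rep hκ hJ c hc (toEmb f x)
    obtain ⟨k, hk⟩ := hJ.exists_ub hM j
    obtain ⟨g, hg⟩ := exists_factor f (c.ι.app k) fun x =>
      ⟨toEmb (F.map (homOfLE (hk x))) (y x), (toEmb_ι_map c (hk x) (y x)).trans (hy x)⟩
    exact ⟨k, g, hg.symm⟩
  · change M ⟶ F.obj i at g
    change M ⟶ F.obj j at g'
    change g ≫ c.ι.app i = g' ≫ c.ι.app j at h
    obtain ⟨k, hk⟩ := hJ.exists_ub_of_finite hκ ![i, j]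
    refine ⟨k, homOfLE (hk 0), homOfLE (hk 1), ?_⟩
    change g ≫ F.map (homOfLE (hk 0)) = g' ≫ F.map (homOfLE (hk 1))
    apply cancel_right (c.ι.app k)
    rw [Category.assoc, Category.assoc, c.w, c.w, h]

section SmallSub

variable (κ : Cardinal.{u}) (M : EmbObj L)

/-- The substructures of `M` of cardinality at most `κ`. -/
abbrev SmallSub : Type u := {S : L.Substructure M.carrier // #S ≤ κ}

variable {κ M}

theorem card_closure_le (hκ : ℵ₀ ≤ κ) (hL : L.card ≤ κ) {s : Set M.carrier} (hs : #s ≤ κ) :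
    #(Substructure.closure L s) ≤ κ := by
  have h := Substructure.lift_card_closure_le (L := L) (s := s)
  simp only [Cardinal.lift_id] at h
  refine h.trans (max_le hκ (add_le_of_le hκ hs (le_trans ?_ hL)))
  rw [card_eq_card_functions_add_card_relations]
  simp [Cardinal.mk_sigma]

theorem isMuDirected_smallSub (hκ : ℵ₀ ≤ κ) (hL : L.card ≤ κ) :
    IsMuDirected (Order.succ κ) (SmallSub κ M) := by
  intro s hs
  have hU : #(⋃ S : s, (S.1.1 : Set M.carrier)) ≤ κ :=
    (mk_iUnion_le _).trans (mul_le_of_le hκ (Order.lt_succ_iff.1 hs)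
      (ciSup_le' fun S => S.1.2))
  exact ⟨⟨Substructure.closure L _, card_closure_le hκ hL hU⟩, fun S hS =>
    (Set.subset_iUnion (fun S : s => (S.1.1 : Set M.carrier)) ⟨S, hS⟩).trans
      Substructure.subset_closure⟩

variable (κ M)

/-- The diagram of substructures of `M` of cardinality at most `κ`. -/
def smallSubDiagram : SmallSub κ M ⥤ EmbObj L where
  obj S := ⟨S.1, inferInstance⟩
  map h := Substructure.inclusion (leOfHom h)
  map_id _ := rfl
  map_comp _ _ := rfl

/-- The inclusions of the small substructures into `M`. -/
def smallSubCocone : Cocone (smallSubDiagram κ M) where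
  pt := M
  ι :=
    { app S := S.1.subtype
      naturality _ _ _ := rfl }

variable {κ M}

theorem exists_smallSub_of_finite (hκ : ℵ₀ ≤ κ) (hL : L.card ≤ κ) {ι : Type*} [Finite ι]
    (x : ι → M.carrier) : ∃ S : SmallSub κ M, ∀ i, x i ∈ S.1 :=
  ⟨⟨Substructure.closure L (Set.range x),
    card_closure_le hκ hL ((lt_aleph0_of_finite _).le.trans hκ)⟩,
    fun i => Substructure.subset_closure ⟨i, rfl⟩⟩

theorem exists_glue (hκ : ℵ₀ ≤ κ) (hL : L.card ≤ κ) (c : Cocone (smallSubDiagram κ M)) :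
    ∃ g : M ⟶ c.pt, ∀ (S : SmallSub κ M) (x : S.1), toEmb g x = toEmb (c.ι.app S) x := by
  choose T hT using fun x : M.carrier => exists_smallSub_of_finite hκ hL fun _ : Unit => x
  let g (x : M.carrier) : c.pt.carrier := toEmb (c.ι.app (T x)) ⟨x, hT x ()⟩
  have hg (S : SmallSub κ M) (x : S.1) : g x = toEmb (c.ι.app S) x := by
    obtain ⟨U, hU⟩ := (isMuDirected_smallSub hκ hL).exists_ub_of_finite hκ ![T x, S]
    exact (toEmb_ι_map c (hU 0) ⟨x, hT x ()⟩).symm.trans (toEmb_ι_map c (hU 1) x)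
  have hg' {n : ℕ} (S : SmallSub κ M) (x : Fin n → M.carrier) (hx : ∀ i, x i ∈ S.1) :
      g ∘ x = toEmb (c.ι.app S) ∘ fun i => (⟨x i, hx i⟩ : S.1) :=
    funext fun i => hg S ⟨x i, hx i⟩
  refine ⟨({ toFun := g, inj' := ?_, map_fun' := ?_, map_rel' := ?_ } : M.carrier ↪[L] _), hg⟩
  · intro x y hxy
    obtain ⟨S, hS⟩ := exists_smallSub_of_finite hκ hL ![x, y]
    have h := ((hg S ⟨x, hS 0⟩).symm.trans hxy).trans (hg S ⟨y, hS 1⟩)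
    exact congrArg Subtype.val ((toEmb (c.ι.app S)).injective h)
  · intro n f x
    obtain ⟨S, hS⟩ := exists_smallSub_of_finite hκ hL x
    rw [hg' S x hS]
    exact (hg S (Structure.funMap f fun i => (⟨x i, hS i⟩ : S.1))).trans
      ((toEmb (c.ι.app S)).map_fun f _)
  · intro n r x
    obtain ⟨S, hS⟩ := exists_smallSub_of_finite hκ hL x
    rw [hg' S x hS]
    exact (toEmb (c.ι.app S)).map_rel r _

theorem nonempty_isColimit_smallSubCocone (hκ : ℵ₀ ≤ κ) (hL : L.card ≤ κ) :
    Nonempty (IsColimit (smallSubCocone κ M)) := by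
  choose g hg using exists_glue (κ := κ) (M := M) hκ hL
  refine ⟨{ desc := g, fac := fun c S => hom_ext (hg c S), uniq := fun c m hm => ?_ }⟩
  refine hom_ext fun x => ?_
  obtain ⟨S, hS⟩ := exists_smallSub_of_finite hκ hL fun _ : Unit => x
  let y : ((smallSubDiagram κ M).obj S).carrier := ⟨x, hS ()⟩
  exact (congrArg (fun k => toEmb k y) (hm S)).trans (hg c S y).symm

theorem card_le_of_isPresentable (hκ : ℵ₀ ≤ κ) (hL : L.card ≤ κ)
    (h : IsPresentable (Order.succ κ) M) : #M.carrier ≤ κ := by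
  obtain ⟨hc⟩ := nonempty_isColimit_smallSubCocone (M := M) hκ hL
  obtain ⟨hP⟩ := h _ (isMuDirected_smallSub hκ hL)
  have : PreservesColimit (smallSubDiagram κ M) (coyoneda.obj (Opposite.op M)) :=
    hP.preservesColimit
  obtain ⟨S, p, hp⟩ := exists_hom_of_preservesColimit_coyoneda hc (X := M) (𝟙 M)
  refine (mk_le_of_surjective (f := ((↑) : S.1 → M.carrier)) fun x => ?_).trans S.2
  exact ⟨toEmb p x, congrArg (fun k => toEmb k x) hp⟩

end SmallSub

end EmbObj

/-- **Statement 4.** Let `L` be a finitary first-order language and `κ` an infinite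
cardinal with `κ ≥ |L|`. In the category `Emb(L)` of all `L`-structures and
`L`-embeddings, a structure `M` is `κ⁺`-presentable if and only if `|M| ≤ κ`. -/
theorem statement4 (L : FirstOrder.Language.{u, u}) (κ : Cardinal.{u})
    (hκ : ℵ₀ ≤ κ) (hL : L.card ≤ κ) (M : EmbObj L) :
    IsPresentable (Order.succ κ) M ↔ #M.carrier ≤ κ := by
  exact ⟨EmbObj.card_le_of_isPresentable hκ hL, EmbObj.isPresentable_of_card_le hκ⟩
end
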